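/- arXiv:1207.0037 — 5 statements merged into one kernel-verified Lean document; each statement's English description precedes it below -/
import Mathlib

section
/- Let an n-player finite game be given, where player i has pure strategy set Fin (s i) (s i ≥ 1) and payoff tensor A i : (Π j, Fin (s j)) → ℝ, and for a mixed strategy profile x (each x j in the probability simplex of Fin (s j)) the expected payoff is u_i(x) = Σ over pure profiles σ of (Π_j x j (σ j)) · A i σ. Then the profile in which every player plays the uniform distribution (x j α = 1/(s j) for all j, α) is a Nash equilibrium if and only if for every player i the row sums of A i are all equal, i.e. for all pure strategies α, β of player i, Σ over opponents' pure profiles τ of A i (α;τ) equals Σ over τ of A i (β;τ). -/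
open Finset

/-- Expected payoff of player `i` in the `n`-player finite game with
strategy counts `s` and payoff tensors `A`, at the mixed profile `x`. -/
noncomputable def payoff {n : ℕ} (s : Fin n → ℕ)
    (A : Fin n → ((∀ j, Fin (s j)) → ℝ)) (i : Fin n)
    (x : ∀ j, Fin (s j) → ℝ) : ℝ :=
  ∑ σ : ∀ j, Fin (s j), (∏ j, x j (σ j)) * A i σ

/-- The full pure profile obtained by inserting pure strategy `α` of player `i`
into the opponents' pure profile `τ`. -/
def insertStrat {n : ℕ} {s : Fin n → ℕ} (i : Fin n) (α : Fin (s i))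
    (τ : ∀ j : {j : Fin n // j ≠ i}, Fin (s j.1)) (j : Fin n) : Fin (s j) :=
  if h : j = i then h ▸ α else τ ⟨j, h⟩

/-- The incentive `φ^D_{iα}(x) = Σ_τ (A i (α;τ) - u_i(x))_+`. -/
noncomputable def phiD {n : ℕ} (s : Fin n → ℕ)
    (A : Fin n → ((∀ j, Fin (s j)) → ℝ)) (i : Fin n) (α : Fin (s i))
    (x : ∀ j, Fin (s j) → ℝ) : ℝ :=
  ∑ τ : ∀ j : {j : Fin n // j ≠ i}, Fin (s j.1),
    max (A i (insertStrat i α τ) - payoff s A i x) 0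

/-- `x` is a mixed strategy profile: each coordinate lies in the probability simplex. -/
def IsMixed {n : ℕ} (s : Fin n → ℕ) (x : ∀ j, Fin (s j) → ℝ) : Prop :=
  ∀ j, (∀ α, 0 ≤ x j α) ∧ ∑ α, x j α = 1

/-- `x` is a Nash equilibrium: `x` is a mixed profile and no player can improve
by a unilateral deviation to another mixed strategy. -/
def IsNash {n : ℕ} (s : Fin n → ℕ) (A : Fin n → ((∀ j, Fin (s j)) → ℝ))
    (x : ∀ j, Fin (s j) → ℝ) : Prop :=
  IsMixed s x ∧ ∀ i : Fin n, ∀ y : Fin (s i) → ℝ,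
    (∀ α, 0 ≤ y α) → (∑ α, y α) = 1 →
      payoff s A i (Function.update x i y) ≤ payoff s A i x

theorem insertStrat_eq_symm {n : ℕ} {s : Fin n → ℕ} (i : Fin n) (α : Fin (s i))
    (τ : ∀ j : {j : Fin n // j ≠ i}, Fin (s j.1)) :
    (Equiv.piSplitAt i (fun j => Fin (s j))).symm (α, τ) = insertStrat i α τ := by
  funext j
  by_cases h : j = i
  · subst h
    simp [Equiv.piSplitAt, insertStrat]
  · simp [Equiv.piSplitAt, insertStrat, h]

theorem payoff_update_unif {n : ℕ} (s : Fin n → ℕ)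
    (A : Fin n → ((∀ j, Fin (s j)) → ℝ)) (i : Fin n) (y : Fin (s i) → ℝ) :
    payoff s A i (Function.update (fun j _ => 1 / (s j : ℝ)) i y) =
      (∏ j ∈ Finset.univ.erase i, 1 / (s j : ℝ)) *
        ∑ α, y α * ∑ τ : ∀ j : {j : Fin n // j ≠ i}, Fin (s j.1), A i (insertStrat i α τ) := by
  unfold payoff
  rw [← Equiv.sum_comp (Equiv.piSplitAt i (fun j => Fin (s j))).symm, Fintype.sum_prod_type,
    Finset.mul_sum]
  refine Finset.sum_congr rfl fun α _ => ?_
  rw [Finset.mul_sum, Finset.mul_sum]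
  refine Finset.sum_congr rfl fun τ _ => ?_
  rw [insertStrat_eq_symm, ← Finset.mul_prod_erase _ _ (Finset.mem_univ i)]
  have h1 : ∏ j ∈ Finset.univ.erase i,
      Function.update (fun j (_ : Fin (s j)) => 1 / (s j : ℝ)) i y j (insertStrat i α τ j) =
      ∏ j ∈ Finset.univ.erase i, 1 / (s j : ℝ) := by
    refine Finset.prod_congr rfl fun j hj => ?_
    rw [Function.update_of_ne (Finset.ne_of_mem_erase hj)]
  have h2 : insertStrat i α τ i = α := by simp [insertStrat]
  rw [h1, Function.update_self, h2]
  ring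

/-- the uniform profile is a Nash equilibrium iff every player's
payoff tensor has equal row sums. -/
theorem uniform_isNash_iff_row_sums_eq {n : ℕ} (s : Fin n → ℕ) (hs : ∀ i, 1 ≤ s i)
    (A : Fin n → ((∀ j, Fin (s j)) → ℝ)) :
    IsNash s A (fun j _ => 1 / (s j : ℝ)) ↔
      ∀ (i : Fin n) (α β : Fin (s i)),
        (∑ τ : ∀ j : {j : Fin n // j ≠ i}, Fin (s j.1), A i (insertStrat i α τ)) =
        (∑ τ : ∀ j : {j : Fin n // j ≠ i}, Fin (s j.1), A i (insertStrat i β τ)) := by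
  have hpos : ∀ j, (0 : ℝ) < s j := fun j => by exact_mod_cast hs j
  have hsum : ∀ j, ∑ _α : Fin (s j), 1 / (s j : ℝ) = 1 := fun j => by
    have := (hpos j).ne'
    simp [this]
  have hc : ∀ i, 0 < ∏ j ∈ Finset.univ.erase i, 1 / (s j : ℝ) := fun i =>
    Finset.prod_pos fun j _ => one_div_pos.mpr (hpos j)
  have hself : ∀ i, payoff s A i (fun j _ => 1 / (s j : ℝ)) =
      payoff s A i (Function.update (fun j _ => 1 / (s j : ℝ)) i (fun _ => 1 / (s i : ℝ))) :=
    fun i => by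
      rw [Function.update_eq_self i (fun j (_ : Fin (s j)) => 1 / (s j : ℝ))]
  constructor
  · rintro ⟨-, h⟩ i
    set R : Fin (s i) → ℝ := fun α =>
      ∑ τ : ∀ j : {j : Fin n // j ≠ i}, Fin (s j.1), A i (insertStrat i α τ) with hR
    have key : ∀ α, R α ≤ ∑ γ, 1 / (s i : ℝ) * R γ := by
      intro α
      have := h i (Pi.single α 1) (fun γ => by
        by_cases hγ : γ = α
        · subst hγ; simp
        · simp [hγ]) (by simp)
      rw [hself, payoff_update_unif, payoff_update_unif] at this
      have := le_of_mul_le_mul_left this (hc i)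
      simpa [Pi.single_apply] using this
    have hz : ∑ γ, ((∑ γ, 1 / (s i : ℝ) * R γ) - R γ) = 0 := by
      rw [Finset.sum_sub_distrib, ← Finset.mul_sum]
      have := (hpos i).ne'
      simp
      field_simp
      simp
    have hall := (Finset.sum_eq_zero_iff_of_nonneg
      (fun γ _ => sub_nonneg.mpr (key γ))).mp hz
    intro α β
    have a := hall α (Finset.mem_univ _)
    have b := hall β (Finset.mem_univ _)
    change R α = R β
    linarith
  · intro h
    refine ⟨fun j => ⟨fun _ => (one_div_pos.mpr (hpos j)).le, hsum j⟩, fun i y _ hy => ?_⟩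
    rw [hself, payoff_update_unif, payoff_update_unif]
    have e : ∀ z : Fin (s i) → ℝ, ∑ α, z α = 1 →
        ∑ α, z α * ∑ τ : ∀ j : {j : Fin n // j ≠ i}, Fin (s j.1), A i (insertStrat i α τ) =
        ∑ τ : ∀ j : {j : Fin n // j ≠ i}, Fin (s j.1), A i (insertStrat i ⟨0, hs i⟩ τ) := by
      intro z hz
      rw [Finset.sum_congr rfl fun α _ => by rw [h i α ⟨0, hs i⟩], ← Finset.sum_mul, hz, one_mul]
    rw [e y hy, e _ (hsum i)]
end

section
/- Let an n-player finite game be given as above and suppose that for each player i the rows of the payoff tensor A i are permutations of each other (for all pure strategies α, β of player i there exists a bijection σ of the opponents' pure profiles with A i (β;τ) = A i (α;σ(τ)) for all τ). If x̂ is an incentive equilibrium for φ^D, then for each player i either φ^D_{iα}(x̂) = 0 for all pure strategies α of i, or x̂ i α = 1/(s i) for all pure strategies α of i. -/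
open Finset

/-- when each player's payoff rows are permutations of each other,
at any incentive equilibrium for `φ^D` each player either has all incentive
components zero or plays the uniform distribution. -/
theorem incentive_equilibrium_zero_or_uniform {n : ℕ} (s : Fin n → ℕ)
    (hs : ∀ i, 1 ≤ s i) (A : Fin n → ((∀ j, Fin (s j)) → ℝ))
    (hperm : ∀ (i : Fin n) (α β : Fin (s i)),
      ∃ σ : (∀ j : {j : Fin n // j ≠ i}, Fin (s j.1)) ≃
            (∀ j : {j : Fin n // j ≠ i}, Fin (s j.1)),
        ∀ τ, A i (insertStrat i β τ) = A i (insertStrat i α (σ τ)))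
    (xhat : ∀ j, Fin (s j) → ℝ) (hx : IsMixed s xhat)
    (heq : ∀ (i : Fin n) (α : Fin (s i)),
      phiD s A i α xhat = xhat i α * ∑ β, phiD s A i β xhat) :
    ∀ i : Fin n,
      (∀ α : Fin (s i), phiD s A i α xhat = 0) ∨
      (∀ α : Fin (s i), xhat i α = 1 / (s i : ℝ)) := by
  intro i
  have key : ∀ α β : Fin (s i), phiD s A i β xhat = phiD s A i α xhat := by
    intro α β
    obtain ⟨σ, hσ⟩ := hperm i α β
    unfold phiD
    simp only [hσ]
    exact Equiv.sum_comp σ (fun τ => max (A i (insertStrat i α τ) - payoff s A i xhat) 0)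
  by_cases h0 : ∀ α : Fin (s i), phiD s A i α xhat = 0
  · exact Or.inl h0
  · right
    intro α
    have hne : phiD s A i α xhat ≠ 0 := fun h => h0 fun β => (key α β).trans h
    have h1 := heq i α
    have h2 : ∑ β, phiD s A i β xhat = (s i : ℝ) * phiD s A i α xhat := by
      rw [Finset.sum_congr rfl (fun β _ => key α β)]
      simp
    rw [h2] at h1
    have hsi : (s i : ℝ) ≠ 0 := by
      have := hs i
      positivity
    rw [eq_div_iff hsi]
    apply mul_right_cancel₀ hne
    linarith
end

section
/- Let an n-player finite game be given as above with, for each player i, the rows of the payoff tensor A i permutations of each other. Let x be a mixed strategy profile with x i α > 0 for all α (player i's strategy is interior), x i not the uniform distribution (x i α ≠ 1/(s i) for some α), and φ^D_{iα₀}(x) > 0 for some pure strategy α₀ of player i. Then the strict incentive-stability inequality holds for player i at the uniform point x̂ i = (1/(s i), …, 1/(s i)): Σ_α (1/(s i)) · φ^D_{iα}(x) / (x i α) > Σ_α x i α · φ^D_{iα}(x) / (x i α) = Σ_α φ^D_{iα}(x). -/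
open Finset

/-- the strict ISS inequality for player `i` at the uniform point,
at any interior non-uniform `x` with some positive incentive component. -/
theorem iss_strict_inequality {n : ℕ} (s : Fin n → ℕ) (hs : ∀ i, 1 ≤ s i)
    (A : Fin n → ((∀ j, Fin (s j)) → ℝ))
    (hperm : ∀ (i : Fin n) (α β : Fin (s i)),
      ∃ σ : (∀ j : {j : Fin n // j ≠ i}, Fin (s j.1)) ≃
            (∀ j : {j : Fin n // j ≠ i}, Fin (s j.1)),
        ∀ τ, A i (insertStrat i β τ) = A i (insertStrat i α (σ τ)))
    (x : ∀ j, Fin (s j) → ℝ) (hx : IsMixed s x) (i : Fin n)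
    (hint : ∀ α : Fin (s i), 0 < x i α)
    (hnu : ∃ α : Fin (s i), x i α ≠ 1 / (s i : ℝ))
    (hpos : ∃ α₀ : Fin (s i), 0 < phiD s A i α₀ x) :
    (∑ α, x i α * (phiD s A i α x / x i α)) < 
      (∑ α, (1 / (s i : ℝ)) * (phiD s A i α x / x i α)) ∧
    (∑ α, x i α * (phiD s A i α x / x i α)) = ∑ α, phiD s A i α x := by
  have hphi : ∀ α β : Fin (s i), phiD s A i α x = phiD s A i β x := by
    intro α β
    obtain ⟨σ, hσ⟩ := hperm i β α
    unfold phiD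
    refine Fintype.sum_equiv σ _ _ ?_
    intro τ
    rw [hσ τ]
  have heq : (∑ α, x i α * (phiD s A i α x / x i α)) = ∑ α, phiD s A i α x :=
    Finset.sum_congr rfl fun α _ => mul_div_cancel₀ _ (hint α).ne'
  refine ⟨?_, heq⟩
  rw [heq]
  obtain ⟨α₀, hα₀⟩ := hpos
  obtain ⟨α₁, hα₁⟩ := hnu
  set c := phiD s A i α₀ x with hc
  have hall : ∀ α, phiD s A i α x = c := fun α => hphi α α₀
  simp only [hall]
  have hS : (0 : ℝ) < (s i : ℝ) := by exact_mod_cast hs i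
  have hsum : ∑ α, c * (2 - (s i : ℝ) * x i α) = ∑ _α : Fin (s i), c := by
    rw [← Finset.mul_sum, Finset.sum_sub_distrib, ← Finset.mul_sum, (hx i).2]
    simp
    ring
  have key : ∀ α, 1 / (s i : ℝ) * (c / x i α) - c * (2 - (s i : ℝ) * x i α)
      = c * (1 - (s i : ℝ) * x i α) ^ 2 / ((s i : ℝ) * x i α) := by
    intro α
    have h1 := (hint α).ne'
    have h2 := hS.ne'
    field_simp
    ring
  rw [← hsum]
  apply Finset.sum_lt_sum
  · intro α _
    have h1 := hint α
    have : 0 ≤ c * (1 - (s i : ℝ) * x i α) ^ 2 / ((s i : ℝ) * x i α) := by positivity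
    linarith [key α]
  · refine ⟨α₁, Finset.mem_univ _, ?_⟩
    have h1 := hint α₁
    have h3 : 1 - (s i : ℝ) * x i α₁ ≠ 0 := by
      intro h
      apply hα₁
      field_simp
      linarith
    have : 0 < c * (1 - (s i : ℝ) * x i α₁) ^ 2 / ((s i : ℝ) * x i α₁) := by positivity
    linarith [key α₁]
end

section
/- Fix reals a, b with a > 0, b > 0, and b > a, and consider the two-player game of generalized (bad) Rock-Paper-Scissors in which player 1's payoff matrix is A = !![0, −b, a; a, 0, −b; −b, a, 0] and player 2's payoff matrix is the transpose Aᵀ (so u₁(x,y) = xᵀ A y and u₂(x,y) = xᵀ Aᵀ ... equivalently u₂(x,y) = yᵀ A x, with x, y in the probability simplex of ℝ³). Then the profile where both players play the uniform distribution (1/3, 1/3, 1/3) is a Nash equilibrium, and it is the unique Nash equilibrium of this game. -/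
open Finset Matrix

/-- Membership in the probability simplex of `ℝ³`. -/
def Simplex3 (x : Fin 3 → ℝ) : Prop := (∀ α, 0 ≤ x α) ∧ ∑ α, x α = 1

/-- Payoff to player 1 in the bimatrix game `(A, Aᵀ)`. -/
def u1 (A : Matrix (Fin 3) (Fin 3) ℝ) (x y : Fin 3 → ℝ) : ℝ :=
  ∑ α, ∑ γ, x α * A α γ * y γ

/-- Payoff to player 2 in the bimatrix game `(A, Aᵀ)`. -/
def u2 (A : Matrix (Fin 3) (Fin 3) ℝ) (x y : Fin 3 → ℝ) : ℝ :=
  ∑ γ, ∑ α, y γ * A γ α * x α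

/-- `(x, y)` is a Nash equilibrium of the bimatrix game `(A, Aᵀ)`. -/
def IsNash2 (A : Matrix (Fin 3) (Fin 3) ℝ) (x y : Fin 3 → ℝ) : Prop :=
  Simplex3 x ∧ Simplex3 y ∧
    (∀ x', Simplex3 x' → u1 A x' y ≤ u1 A x y) ∧
    (∀ y', Simplex3 y' → u2 A x y' ≤ u2 A x y)

/-- Complementary slackness. -/
lemma rps_slack (x0 x1 x2 p0 p1 p2 v : ℝ) (h0 : 0 ≤ x0) (h1 : 0 ≤ x1) (h2 : 0 ≤ x2)
    (hs : x0 + x1 + x2 = 1) (hv : x0 * p0 + x1 * p1 + x2 * p2 = v)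
    (l0 : p0 ≤ v) (l1 : p1 ≤ v) (l2 : p2 ≤ v) :
    (x0 = 0 ∨ p0 = v) ∧ (x1 = 0 ∨ p1 = v) ∧ (x2 = 0 ∨ p2 = v) := by
  have e : x0 * (v - p0) + x1 * (v - p1) + x2 * (v - p2) = 0 := by
    linear_combination v * hs - hv
  have m0 := mul_nonneg h0 (sub_nonneg.2 l0)
  have m1 := mul_nonneg h1 (sub_nonneg.2 l1)
  have m2 := mul_nonneg h2 (sub_nonneg.2 l2)
  have key : ∀ x p : ℝ, x * (v - p) = 0 → x = 0 ∨ p = v := by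
    intro x p h
    rcases mul_eq_zero.1 h with h | h
    · exact Or.inl h
    · right; linarith
  exact ⟨key _ _ (by linarith), key _ _ (by linarith), key _ _ (by linarith)⟩

/-- If `y2` is zero then row 0 is strictly worse than row 1. -/
lemma rps_zero (a b x0 y0 y1 y2 v : ℝ) (ha : 0 < a) (hb : 0 < b) (h0 : 0 ≤ y0) (h1 : 0 ≤ y1)
    (hs : y0 + y1 + y2 = 1) (hx : x0 = 0 ∨ -b * y1 + a * y2 = v)
    (l1 : a * y0 - b * y2 ≤ v) (hy : y2 = 0) : x0 = 0 := by
  rcases hx with h | h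
  · exact h
  · exfalso
    subst hy
    have := mul_nonneg ha.le h0
    have := mul_nonneg hb.le h1
    have e0 : a * y0 = 0 := by linarith
    have e1 : b * y1 = 0 := by linarith
    have := (mul_eq_zero.1 e0).resolve_left ha.ne'
    have := (mul_eq_zero.1 e1).resolve_left hb.ne'
    linarith

lemma rps_solve (a b y0 y1 y2 v : ℝ) (ha : 0 < a) (hb : 0 < b)
    (hs : y0 + y1 + y2 = 1) (e0 : -b * y1 + a * y2 = v)
    (e1 : a * y0 - b * y2 = v) (e2 : -b * y0 + a * y1 = v) :
    y0 = 1 / 3 ∧ y1 = 1 / 3 ∧ y2 = 1 / 3 := by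
  have hv : v = (a - b) / 3 := by linear_combination (-1/3) * (e0 + e1 + e2) + (a - b) / 3 * hs
  have hD : 0 < a ^ 2 + a * b + b ^ 2 := by positivity
  have aux : ∀ t : ℝ, (a ^ 2 + a * b + b ^ 2) * (t - 1 / 3) = 0 → t = 1 / 3 := by
    intro t h
    have := (mul_eq_zero.1 h).resolve_left hD.ne'
    linarith
  have k0 : (a ^ 2 + a * b + b ^ 2) * (y0 - 1 / 3) = 0 := by
    linear_combination a * e1 - b * e2 + a * b * hs + (a - b) * hv
  have k1 : (a ^ 2 + a * b + b ^ 2) * (y1 - 1 / 3) = 0 := by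
    linear_combination a * e2 - b * e0 + a * b * hs + (a - b) * hv
  have := aux _ k0
  have := aux _ k1
  exact ⟨aux _ k0, aux _ k1, by linarith⟩

lemma rps_pure (i : Fin 3) : Simplex3 (Pi.single i 1) := by
  constructor
  · intro j; by_cases h : j = i
    · subst h; simp
    · simp [h]
  · simp

theorem badRPS_unique_nash (a b : ℝ) (ha : 0 < a) (hb : 0 < b) (hba : a < b) :
    IsNash2 !![0, -b, a; a, 0, -b; -b, a, 0]
        (fun _ => 1 / 3) (fun _ => 1 / 3) ∧
      ∀ x y : Fin 3 → ℝ, IsNash2 !![0, -b, a; a, 0, -b; -b, a, 0] x y →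
        x = (fun _ => 1 / 3) ∧ y = (fun _ => 1 / 3) := by
  constructor
  · have hu : Simplex3 (fun _ => 1 / 3) := ⟨fun _ => by norm_num, by simp⟩
    refine ⟨hu, hu, ?_, ?_⟩
    · rintro z ⟨-, hz⟩
      simp only [Fin.sum_univ_three] at hz
      simp [u1, Fin.sum_univ_three]
      apply le_of_eq
      linear_combination (a - b) / 3 * hz
    · rintro z ⟨-, hz⟩
      simp only [Fin.sum_univ_three] at hz
      simp [u2, Fin.sum_univ_three]
      apply le_of_eq
      linear_combination (a - b) / 3 * hz
  · rintro x y ⟨⟨hx, hxs⟩, ⟨hy, hys⟩, h1, h2⟩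
    have p0 := h1 _ (rps_pure 0)
    have p1 := h1 _ (rps_pure 1)
    have p2 := h1 _ (rps_pure 2)
    have q0 := h2 _ (rps_pure 0)
    have q1 := h2 _ (rps_pure 1)
    have q2 := h2 _ (rps_pure 2)
    have hv : x 0 * (-b * y 1 + a * y 2) + x 1 * (a * y 0 - b * y 2) + x 2 * (-b * y 0 + a * y 1)
        = u1 !![0, -b, a; a, 0, -b; -b, a, 0] x y := by
      simp [u1, Fin.sum_univ_three]; ring
    have hw : y 0 * (-b * x 1 + a * x 2) + y 1 * (a * x 0 - b * x 2) + y 2 * (-b * x 0 + a * x 1)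
        = u2 !![0, -b, a; a, 0, -b; -b, a, 0] x y := by
      simp [u2, Fin.sum_univ_three]; ring
    generalize u1 !![0, -b, a; a, 0, -b; -b, a, 0] x y = v at *
    generalize u2 !![0, -b, a; a, 0, -b; -b, a, 0] x y = w at *
    simp [u1, u2, Fin.sum_univ_three] at p0 p1 p2 q0 q1 q2
    simp only [Fin.sum_univ_three] at hxs hys
    obtain ⟨s0, s1, s2⟩ := rps_slack _ _ _ _ _ _ v (hx 0) (hx 1) (hx 2) hxs hv
      (by linarith) (by linarith) (by linarith)
    obtain ⟨t0, t1, t2⟩ := rps_slack _ _ _ _ _ _ w (hy 0) (hy 1) (hy 2) hys hw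
      (by linarith) (by linarith) (by linarith)
    have y2x0 := rps_zero a b (x 0) (y 0) (y 1) (y 2) v ha hb (hy 0) (hy 1) hys s0 (by linarith)
    have y0x1 := rps_zero a b (x 1) (y 1) (y 2) (y 0) v ha hb (hy 1) (hy 2) (by linarith)
      (s1.imp_right fun h => by linarith) (by linarith)
    have y1x2 := rps_zero a b (x 2) (y 2) (y 0) (y 1) v ha hb (hy 2) (hy 0) (by linarith)
      (s2.imp_right fun h => by linarith) (by linarith)
    have x2y0 := rps_zero a b (y 0) (x 0) (x 1) (x 2) w ha hb (hx 0) (hx 1) hxs t0 (by linarith)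
    have x0y1 := rps_zero a b (y 1) (x 1) (x 2) (x 0) w ha hb (hx 1) (hx 2) (by linarith)
      (t1.imp_right fun h => by linarith) (by linarith)
    have x1y2 := rps_zero a b (y 2) (x 2) (x 0) (x 1) w ha hb (hx 2) (hx 0) (by linarith)
      (t2.imp_right fun h => by linarith) (by linarith)
    have ny0 : y 0 ≠ 0 := fun h => by
      have h2 := x1y2 (y0x1 h)
      have h1 := x0y1 (y2x0 h2)
      linarith
    have ny2 : y 2 ≠ 0 := fun h => ny0 (x2y0 (y1x2 (x0y1 (y2x0 h))))
    have ny1 : y 1 ≠ 0 := fun h => ny0 (x2y0 (y1x2 h))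
    have nx0 : x 0 ≠ 0 := fun h => ny1 (x0y1 h)
    have nx1 : x 1 ≠ 0 := fun h => ny2 (x1y2 h)
    have nx2 : x 2 ≠ 0 := fun h => ny0 (x2y0 h)
    obtain ⟨a0, a1, a2⟩ := rps_solve a b _ _ _ v ha hb hys (s0.resolve_left nx0)
      (s1.resolve_left nx1) (s2.resolve_left nx2)
    obtain ⟨b0, b1, b2⟩ := rps_solve a b _ _ _ w ha hb hxs (t0.resolve_left ny0)
      (t1.resolve_left ny1) (t2.resolve_left ny2)
    constructor
    · funext i; fin_cases i <;> assumption
    · funext i; fin_cases i <;> assumption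
end

section
/- Let an n-player finite game be given as above in which, for each player i, every row of the payoff tensor A i is a permutation of the first row (for each pure strategy β of player i there is a bijection σ of the opponents' pure profiles with A i (β;τ) = A i (α₁;σ(τ)) for all τ, where α₁ is a fixed pure strategy of i). If the uniform profile x̂ (every player plays the uniform distribution) is a Nash equilibrium, then x̂ is an incentive equilibrium for φ^D. -/
open Finset

/-- if for each player every row of its payoff tensor is a
permutation of a fixed first row and the uniform profile is a Nash equilibrium,
then the uniform profile is an incentive equilibrium for `φ^D`. -/
theorem uniform_nash_is_incentive_equilibrium {n : ℕ} (s : Fin n → ℕ)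
    (hs : ∀ i, 1 ≤ s i) (A : Fin n → ((∀ j, Fin (s j)) → ℝ))
    (hperm : ∀ i : Fin n, ∃ α₁ : Fin (s i), ∀ β : Fin (s i),
      ∃ σ : (∀ j : {j : Fin n // j ≠ i}, Fin (s j.1)) ≃
            (∀ j : {j : Fin n // j ≠ i}, Fin (s j.1)),
        ∀ τ, A i (insertStrat i β τ) = A i (insertStrat i α₁ (σ τ)))
    (hNash : IsNash s A (fun j _ => 1 / (s j : ℝ))) :
    ∀ (i : Fin n) (α : Fin (s i)),
      phiD s A i α (fun j _ => 1 / (s j : ℝ)) =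
        (1 / (s i : ℝ)) * ∑ β, phiD s A i β (fun j _ => 1 / (s j : ℝ)) := by
  intro i α
  obtain ⟨α₁, h⟩ := hperm i
  have key : ∀ β, phiD s A i β (fun j _ => 1 / (s j : ℝ)) =
      phiD s A i α₁ (fun j _ => 1 / (s j : ℝ)) := by
    intro β
    obtain ⟨σ, hσ⟩ := h β
    unfold phiD
    exact Fintype.sum_equiv σ _ _ (fun τ => by rw [hσ τ])
  have hpos : (s i : ℝ) ≠ 0 := by
    have := hs i
    positivity
  rw [Finset.sum_congr rfl (fun β _ => key β), key α, Finset.sum_const, Finset.card_univ,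
    Fintype.card_fin, nsmul_eq_mul]
  field_simp
end
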